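/- Let (M,g) be an integral P_l(𝓞)-module. For 1 ≤ i ≤ l let R_i be an 𝓞-submodule of Q_i(M) that is free as an 𝓞-module of rank r_i and has finite additive index h_i in Q_i(M). Then the number of standard submodules S of finite index in M satisfying R_i(S) = R_i for all 1 ≤ i ≤ l (where R_i(S) denotes the image of Q_i(S) in Q_i(M) under the map induced by inclusion) is exactly ∏_{i=1}^l (h_i · h_{i+1} ⋯ h_l)^{(r_i + r_{i+1} + ⋯ + r_l)} / h_i^{r_i}. -/

import Mathlib

open NumberField

/-- For an `R`-module endomorphism `g`, `kerPow g i = K_i = ker (g^i)`. -/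
def kerPow {R M : Type*} [CommRing R] [AddCommGroup M] [Module R M]
    (g : M →ₗ[R] M) (i : ℕ) : Submodule R M :=
  LinearMap.ker (g ^ i)

/-- `Isub g i j = I_{i,j} = g^{j-i}(K_j) + K_{i-1}`. -/
def Isub {R M : Type*} [CommRing R] [AddCommGroup M] [Module R M]
    (g : M →ₗ[R] M) (i j : ℕ) : Submodule R M :=
  (kerPow g j).map (g ^ (j - i)) ⊔ kerPow g (i - 1)

/-- `Lsub g i = L_i = g(K_{i+1}) + K_{i-1}`. -/
def Lsub {R M : Type*} [CommRing R] [AddCommGroup M] [Module R M]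
    (g : M →ₗ[R] M) (i : ℕ) : Submodule R M :=
  (kerPow g (i + 1)).map g ⊔ kerPow g (i - 1)

/-- `Qquot g i = Q_i = K_i / L_i` as an `R`-module. -/
abbrev Qquot {R M : Type*} [CommRing R] [AddCommGroup M] [Module R M]
    (g : M →ₗ[R] M) (i : ℕ) :=
  ↥(kerPow g i) ⧸ (Lsub g i).comap (kerPow g i).subtype

/-- Counting lemma: fibers are cosets of subgroups of constant finite index. -/
lemma card_of_coset_fibers {A X : Type*} [AddCommGroup A] [Module.Finite ℤ A] (Φ : A → X)
    (hΦ : Function.Surjective Φ) (H : X → AddSubgroup A) (c : ℕ) (hc : c ≠ 0)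
    (hH : ∀ x, (H x).index = c) (hfib : ∀ a b, Φ a = Φ b ↔ b - a ∈ H (Φ a)) :
    Nat.card X = c := by
  classical
  set D : AddSubgroup A := (nsmulAddMonoidHom (α := A) c).range with hD
  have hDH : ∀ x, D ≤ H x := by
    rintro x _ ⟨a, rfl⟩
    have := (H x).nsmul_index_mem a
    rw [hH] at this
    simpa using this
  have : Finite (A ⧸ D) := by
    have : AddGroup.FG A := Module.Finite.iff_addGroup_fg.mp inferInstance
    have : Module.Finite ℤ (A ⧸ D) :=
      Module.Finite.of_surjective (QuotientAddGroup.mk' D).toIntLinearMap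
        (QuotientAddGroup.mk'_surjective D)
    apply Module.finite_of_fg_torsion
    intro q
    obtain ⟨a, rfl⟩ := QuotientAddGroup.mk'_surjective D q
    refine ⟨⟨(c : ℤ), by simpa using hc⟩, ?_⟩
    change (c : ℤ) • (QuotientAddGroup.mk' D a) = 0
    rw [← map_zsmul]
    refine (QuotientAddGroup.eq_zero_iff _).mpr ⟨a, by simp⟩
  have hDind : D.index ≠ 0 := Nat.card_pos.ne'
  let Ψ : A ⧸ D → X := Quotient.lift Φ (by
    intro a b hab
    rw [hfib]
    have : -a + b ∈ D := QuotientAddGroup.leftRel_apply.mp hab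
    have := hDH (Φ a) this
    rwa [neg_add_eq_sub] at this)
  have hΨ : ∀ a : A, Ψ (QuotientAddGroup.mk' D a) = Φ a := fun a => rfl
  have hΨs : Function.Surjective Ψ := fun x => by
    obtain ⟨a, rfl⟩ := hΦ x
    exact ⟨_, hΨ a⟩
  have : Finite X := Finite.of_surjective Ψ hΨs
  have := Fintype.ofFinite X
  have hcard : ∀ x, Nat.card {q // Ψ q = x} * c = D.index := by
    intro x
    obtain ⟨a, rfl⟩ := hΦ x
    have e : {q // Ψ q = Φ a} ≃ ((H (Φ a)).map (QuotientAddGroup.mk' D)) := by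
      refine (Equiv.subRight (QuotientAddGroup.mk' D a)).subtypeEquiv ?_
      intro q
      obtain ⟨b, rfl⟩ := QuotientAddGroup.mk'_surjective D q
      rw [hΨ, eq_comm, hfib]
      simp only [Equiv.subRight_apply]
      rw [← map_sub]
      constructor
      · intro h; exact ⟨_, h, rfl⟩
      · rintro ⟨d, hd, hde⟩
        have h1 : -d + (b - a) ∈ D := QuotientAddGroup.eq.mp hde
        have h2 := (H (Φ a)).add_mem hd (hDH _ h1)
        simpa using h2
    rw [Nat.card_congr e, ← AddSubgroup.relIndex_ker, QuotientAddGroup.ker_mk', ← hH (Φ a)]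
    exact AddSubgroup.relIndex_mul_index (hDH _)
  have htot : D.index = ∑ x : X, Nat.card {q // Ψ q = x} := by
    rw [← Nat.card_sigma]
    exact Nat.card_congr (Equiv.sigmaFiberEquiv Ψ).symm
  have h3 : D.index * c = Nat.card X * D.index := by
    conv_lhs => rw [htot]
    rw [Finset.sum_mul, Finset.sum_congr rfl (fun x _ => hcard x)]
    simp
  rw [mul_comm] at h3
  exact (Nat.eq_of_mul_eq_mul_right (Nat.pos_of_ne_zero hDind) h3).symm

section core
variable {R M : Type*} [CommRing R] [AddCommGroup M] [Module R M]

/-- index of `A ∩ S` in `A` -/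
noncomputable def rix (S A : Submodule R M) : ℕ := S.toAddSubgroup.relIndex A.toAddSubgroup

lemma rix_congr {S S' A : Submodule R M} (h : ∀ x ∈ A, x ∈ S ↔ x ∈ S') : rix S A = rix S' A := by
  unfold rix
  rw [← AddSubgroup.inf_relIndex_right, ← AddSubgroup.inf_relIndex_right S'.toAddSubgroup]
  congr 1
  ext x
  simp only [AddSubgroup.mem_inf, Submodule.mem_toAddSubgroup]
  constructor
  · rintro ⟨a, b⟩; exact ⟨(h x b).1 a, b⟩
  · rintro ⟨a, b⟩; exact ⟨(h x b).2 a, b⟩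

lemma rix_map (S A : Submodule R M) (g : M →ₗ[R] M) : rix S (A.map g) = rix (S.comap g) A := by
  unfold rix
  have := AddSubgroup.relIndex_comap S.toAddSubgroup (g.toAddMonoidHom) A.toAddSubgroup
  exact this.symm

lemma rix_sup (S A : Submodule R M) : rix S (A ⊔ S) = rix S A := by
  unfold rix
  rw [Submodule.sup_toAddSubgroup]
  exact AddSubgroup.relIndex_sup_right _ _

/-- multiplicativity -/
lemma rix_mul (S A B : Submodule R M) (h : B ≤ A) : rix S A = rix S B * rix (S ⊔ B) A := by
  have h1 : rix S A = (S ⊓ A).toAddSubgroup.relIndex A.toAddSubgroup := by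
    unfold rix
    rw [← AddSubgroup.inf_relIndex_right]; rfl
  have h2 : rix S B = (S ⊓ A).toAddSubgroup.relIndex (B ⊔ (S ⊓ A)).toAddSubgroup := by
    have : rix S B = rix (S ⊓ A) B :=
      rix_congr fun x hx => ⟨fun hs => ⟨hs, h hx⟩, fun hs => hs.1⟩
    rw [this, ← rix_sup]; rfl
  have h3 : rix (S ⊔ B) A = (B ⊔ (S ⊓ A)).toAddSubgroup.relIndex A.toAddSubgroup := by
    apply rix_congr
    intro x hx
    have : (S ⊔ B) ⊓ A = B ⊔ (S ⊓ A) := by rw [sup_comm, sup_inf_assoc_of_le _ h]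
    rw [← this]; simp [hx]
  rw [h1, h2, h3]
  exact (AddSubgroup.relIndex_mul_relIndex _ _ _
    (show S ⊓ A ≤ B ⊔ S ⊓ A from le_sup_right) (show B ⊔ S ⊓ A ≤ A from sup_le h inf_le_right)).symm

lemma rix_one {S A : Submodule R M} (h : A ≤ S) : rix S A = 1 :=
  AddSubgroup.relIndex_eq_one.mpr h

lemma rix_sup_right (S A B : Submodule R M) (h : B ≤ S) : rix S (A ⊔ B) = rix S A := by
  have : rix S (A ⊔ S) = rix S (A ⊔ B) * rix (S ⊔ (A ⊔ B)) (A ⊔ S) :=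
    rix_mul _ _ _ (sup_le_sup_left h _)
  rw [rix_one (S := S ⊔ (A ⊔ B)), mul_one, rix_sup] at this
  · exact this.symm
  · exact sup_le (le_sup_of_le_right le_sup_left) le_sup_left

lemma mem_kerPow {g : M →ₗ[R] M} {i : ℕ} {x : M} : x ∈ kerPow g i ↔ (g ^ i) x = 0 := Iff.rfl

lemma g_mem_kerPow {g : M →ₗ[R] M} {i : ℕ} {x : M} : g x ∈ kerPow g i ↔ x ∈ kerPow g (i + 1) := by
  rw [mem_kerPow, mem_kerPow, pow_succ]; rfl

lemma kerPow_mono (g : M →ₗ[R] M) (i : ℕ) : kerPow g i ≤ kerPow g (i + 1) := by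
  intro x hx
  rw [mem_kerPow] at *
  rw [pow_succ', Module.End.mul_apply, hx, map_zero]

lemma kerPow_zero (g : M →ₗ[R] M) : kerPow g 0 = ⊥ := by
  ext x; simp [mem_kerPow]

lemma Lsub_succ (g : M →ₗ[R] M) (i : ℕ) :
    Lsub g (i + 1) = (kerPow g (i + 2)).map g ⊔ kerPow g i := rfl

lemma kerPow_le_Lsub (g : M →ₗ[R] M) (i : ℕ) : kerPow g i ≤ Lsub g (i + 1) := le_sup_right

lemma Lsub_le (g : M →ₗ[R] M) (i : ℕ) : Lsub g (i + 1) ≤ kerPow g (i + 1) := by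
  rw [Lsub_succ]
  refine sup_le ?_ (kerPow_mono g i)
  rintro _ ⟨x, hx, rfl⟩
  exact g_mem_kerPow.mpr hx

/-- good submodules -/
structure Good (g : M →ₗ[R] M) (l : ℕ) (P : ℕ → Submodule R M) (S : Submodule R M) : Prop where
  inv : ∀ x ∈ S, g x ∈ S
  img : ∀ i < l, (S ⊓ kerPow g (i + 1)) ⊔ Lsub g (i + 1) = P (i + 1)
  cap : ∀ i < l, ∀ x ∈ S, x ∈ Lsub g (i + 1) →
    ∃ s ∈ S, s ∈ kerPow g (i + 2) ∧ ∃ t ∈ S, t ∈ kerPow g i ∧ x = g s + t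

section goodsec
variable {g : M →ₗ[R] M} {l : ℕ} {P : ℕ → Submodule R M} {S : Submodule R M}

lemma Good.rix_L (hS : Good g l P S) {i : ℕ} (hi : i < l) :
    rix (S ⊔ kerPow g i) (Lsub g (i + 1)) = rix (S ⊔ kerPow g (i + 1)) (kerPow g (i + 2)) := by
  rw [Lsub_succ, rix_sup_right _ _ _ le_sup_right, rix_map]
  apply rix_congr
  intro x hx
  rw [Submodule.mem_comap, Submodule.mem_sup, Submodule.mem_sup]
  constructor
  · rintro ⟨s, hs, k, hk, hsk⟩
    have hL : s ∈ Lsub g (i + 1) := by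
      have h1 : g x ∈ Lsub g (i + 1) := Submodule.mem_sup_left ⟨x, hx, rfl⟩
      have h2 := (Lsub g (i + 1)).sub_mem h1 (kerPow_le_Lsub g i hk)
      rwa [← hsk, add_sub_cancel_right] at h2
    obtain ⟨s', hs', hs'k, t, ht, htk, rfl⟩ := hS.cap i hi s hs hL
    refine ⟨s', hs', x - s', ?_, by abel⟩
    rw [← g_mem_kerPow, map_sub, ← hsk]
    have : g s' + t + k - g s' = t + k := by abel
    rw [this]
    exact add_mem htk hk
  · rintro ⟨s, hs, k, hk, rfl⟩
    exact ⟨g s, hS.inv _ hs, g k, g_mem_kerPow.mpr hk, by simp⟩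

lemma Good.rix_P (hS : Good g l P S) {i : ℕ} (hi : i < l) :
    rix (S ⊔ Lsub g (i + 1)) (kerPow g (i + 1)) = rix (P (i + 1)) (kerPow g (i + 1)) := by
  apply rix_congr
  intro x hx
  rw [← hS.img i hi, sup_comm, sup_comm _ (Lsub g (i + 1)), ← sup_inf_assoc_of_le _ (Lsub_le g i)]
  simp [hx]

lemma Good.u_rec (hS : Good g l P S) {i : ℕ} (hi : i < l) :
    rix (S ⊔ kerPow g i) (kerPow g (i + 1)) =
      rix (P (i + 1)) (kerPow g (i + 1)) * rix (S ⊔ kerPow g (i + 1)) (kerPow g (i + 2)) := by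
  rw [rix_mul _ _ _ (Lsub_le g i), hS.rix_L hi, mul_comm, sup_assoc,
    sup_of_le_right (kerPow_le_Lsub g i), hS.rix_P hi]

lemma kerPow_top (hg : g ^ l = 0) {i : ℕ} (hi : l ≤ i) : kerPow g i = ⊤ := by
  ext x
  simp [mem_kerPow, pow_eq_zero_of_le hi hg]

lemma Good.u_eq (hg : g ^ l = 0) (hS : Good g l P S) {i : ℕ} (hi : i ≤ l) :
    rix (S ⊔ kerPow g i) (kerPow g (i + 1)) =
      ∏ j ∈ Finset.Icc (i + 1) l, rix (P j) (kerPow g j) := by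
  induction hi using Nat.decreasingInduction with
  | self =>
    rw [kerPow_top hg le_rfl, rix_one (by simp)]; simp
  | of_succ k hk ih =>
    rw [hS.u_rec hk, ih, ← Finset.mul_prod_Ioc_eq_prod_Icc (a := k + 1) (by omega)]
    congr 1
    refine Finset.prod_congr ?_ fun _ _ => rfl
    ext x
    simp only [Finset.mem_Icc, Finset.mem_Ioc]
    omega

lemma Good.k_eq (hg : g ^ l = 0) (hS : Good g l P S) {i : ℕ} (hi : i ≤ l) :
    rix S (kerPow g i) = ∏ m ∈ Finset.Icc 1 i, ∏ j ∈ Finset.Icc m l, rix (P j) (kerPow g j) := by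
  induction i with
  | zero => rw [kerPow_zero, rix_one (by simp)]; simp
  | succ i ih =>
    rw [rix_mul S _ _ (kerPow_mono g i), ih (by omega), hS.u_eq hg (by omega),
      Finset.prod_Icc_succ_top (by omega)]

lemma Good.ell_eq (hg : g ^ l = 0) (hS : Good g l P S) {i : ℕ} (hi : i < l) :
    rix S (Lsub g (i + 1)) * rix (P (i + 1)) (kerPow g (i + 1)) =
      ∏ m ∈ Finset.Icc 1 (i + 1), ∏ j ∈ Finset.Icc m l, rix (P j) (kerPow g j) := by
  rw [← hS.k_eq hg (by omega), rix_mul S _ _ (Lsub_le g i), hS.rix_P hi]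

lemma Good.index_eq (hg : g ^ l = 0) (hS : Good g l P S) :
    S.toAddSubgroup.index =
      ∏ m ∈ Finset.Icc 1 l, ∏ j ∈ Finset.Icc m l, rix (P j) (kerPow g j) := by
  rw [← hS.k_eq hg le_rfl, kerPow_top hg le_rfl]
  exact (AddSubgroup.relIndex_top_right _).symm

lemma Good.index_ne_zero (hg : g ^ l = 0) (hP : ∀ i < l, rix (P (i + 1)) (kerPow g (i + 1)) ≠ 0)
    (hS : Good g l P S) : S.toAddSubgroup.index ≠ 0 := by
  rw [hS.index_eq hg]
  refine Finset.prod_ne_zero_iff.mpr fun m hm => Finset.prod_ne_zero_iff.mpr fun j hj => ?_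
  simp only [Finset.mem_Icc] at hm hj
  obtain ⟨j, rfl⟩ : ∃ k, j = k + 1 := ⟨j - 1, by omega⟩
  exact hP j (by omega)

lemma Good.eq_of_le (hg : g ^ l = 0) (hP : ∀ i < l, rix (P (i + 1)) (kerPow g (i + 1)) ≠ 0)
    {T : Submodule R M} (hS : Good g l P S) (hT : Good g l P T) (h : S ≤ T) : S = T := by
  refine le_antisymm h ?_
  have h1 : S.toAddSubgroup.relIndex T.toAddSubgroup * T.toAddSubgroup.index
      = S.toAddSubgroup.index := AddSubgroup.relIndex_mul_index h
  have h2 : S.toAddSubgroup.index = T.toAddSubgroup.index := by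
    rw [hS.index_eq hg, hT.index_eq hg]
  rw [h2] at h1
  have h3 : S.toAddSubgroup.relIndex T.toAddSubgroup = 1 :=
    Nat.eq_of_mul_eq_mul_right (Nat.pos_of_ne_zero (hT.index_ne_zero hg hP)) (by rw [h1, one_mul])
  exact AddSubgroup.relIndex_eq_one.mp h3

/-- `W i = ∑ g^k Y (i+k)` -/
def Wsub (g : M →ₗ[R] M) (Y : ℕ → Submodule R M) (i : ℕ) : Submodule R M :=
  ⨆ k, (Y (i + k)).map (g ^ k)

lemma Wsub_eq (g : M →ₗ[R] M) (Y : ℕ → Submodule R M) (i : ℕ) :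
    Wsub g Y i = Y i ⊔ (Wsub g Y (i + 1)).map g := by
  unfold Wsub
  rw [← sup_iSup_nat_succ, Submodule.map_iSup]
  congr 1
  · rw [pow_zero]; exact (Submodule.map_id (Y i))
  · refine iSup_congr fun k => ?_
    rw [← Submodule.map_comp, pow_succ', Nat.add_right_comm, ← add_assoc]; rfl

/-- partial sums of the `W` -/
def Tsub (g : M →ₗ[R] M) (Y : ℕ → Submodule R M) : ℕ → Submodule R M
  | 0 => ⊥
  | i + 1 => Tsub g Y i ⊔ Wsub g Y (i + 1)

section Ysec
variable {Y : ℕ → Submodule R M}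

lemma Wsub_le_kerPow (hY : ∀ i, Y i ≤ kerPow g i) (i : ℕ) : Wsub g Y i ≤ kerPow g i := by
  refine iSup_le fun k => ?_
  rintro _ ⟨y, hy, rfl⟩
  have := hY _ hy
  rw [mem_kerPow] at *
  rwa [← Module.End.mul_apply, ← pow_add]

lemma Tsub_le_kerPow (hY : ∀ i, Y i ≤ kerPow g i) (i : ℕ) : Tsub g Y i ≤ kerPow g i := by
  induction i with
  | zero => exact bot_le
  | succ i ih => exact sup_le (ih.trans (kerPow_mono g i)) (Wsub_le_kerPow hY _)

lemma Wsub_cap (hY : ∀ i, Y i ≤ kerPow g i) (hY0 : ∀ i, l < i → Y i = ⊥)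
    (hYL : ∀ i < l, ∀ y ∈ Y (i + 1), y ∈ Lsub g (i + 1) → y = 0) {i : ℕ} (hi : i ≤ l) :
    ∀ w ∈ Wsub g Y (i + 1), w ∈ kerPow g i → w = 0 := by
  induction hi using Nat.decreasingInduction with
  | self =>
    intro w hw _
    have : Wsub g Y (l + 1) = ⊥ := by
      refine iSup_eq_bot.mpr fun k => ?_
      rw [hY0 _ (by omega), Submodule.map_bot]
    simpa [this] using hw
  | of_succ k hk ih =>
    intro w hw hwk
    rw [Wsub_eq] at hw
    obtain ⟨y, hy, _, ⟨w', hw', rfl⟩, rfl⟩ := Submodule.mem_sup.mp hw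
    have hgw : g w' ∈ Lsub g (k + 1) :=
      Submodule.mem_sup_left ⟨w', Wsub_le_kerPow hY _ hw', rfl⟩
    have hyL : y ∈ Lsub g (k + 1) := by
      have := (Lsub g (k + 1)).sub_mem (kerPow_le_Lsub g k hwk) hgw
      rwa [add_sub_cancel_right] at this
    have hy0 := hYL k hk y hy hyL
    subst hy0
    rw [zero_add] at hwk
    rw [ih w' hw' (g_mem_kerPow.mp hwk)]
    simp

lemma Tsub_mono {i j : ℕ} (h : i ≤ j) : Tsub g Y i ≤ Tsub g Y j := by
  induction j, h using Nat.le_induction with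
  | base => exact le_rfl
  | succ j _ ih => exact ih.trans le_sup_left

lemma Tsub_cap (hY : ∀ i, Y i ≤ kerPow g i) (hY0 : ∀ i, l < i → Y i = ⊥)
    (hYL : ∀ i < l, ∀ y ∈ Y (i + 1), y ∈ Lsub g (i + 1) → y = 0) {i : ℕ} (hi : i ≤ l) :
    ∀ x ∈ Tsub g Y l, x ∈ kerPow g i → x ∈ Tsub g Y i := by
  induction hi using Nat.decreasingInduction with
  | self => intro x hx _; exact hx
  | of_succ k hk ih =>
    intro x hx hxk
    have h1 := ih x hx (kerPow_mono g k hxk)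
    obtain ⟨t, ht, w, hw, rfl⟩ := Submodule.mem_sup.mp h1
    have hwk : w ∈ kerPow g k := by
      have := (kerPow g k).sub_mem hxk (Tsub_le_kerPow hY k ht)
      rwa [add_sub_cancel_left] at this
    rw [Wsub_cap hY hY0 hYL hk.le w hw hwk, add_zero]
    exact ht

lemma Tsub_g (hY : ∀ i, Y i ≤ kerPow g i) (i : ℕ) :
    ∀ x ∈ Tsub g Y (i + 1), g x ∈ Tsub g Y i := by
  induction i with
  | zero =>
    intro x hx
    have := Tsub_le_kerPow hY _ hx
    rw [← g_mem_kerPow, kerPow_zero] at this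
    exact this
  | succ i ih =>
    intro x hx
    obtain ⟨t, ht, w, hw, rfl⟩ := Submodule.mem_sup.mp hx
    rw [map_add]
    refine add_mem (Tsub_mono (Nat.le_succ i) (ih t ht)) (Submodule.mem_sup_right ?_)
    rw [Wsub_eq]
    exact Submodule.mem_sup_right ⟨w, hw, rfl⟩

lemma Tsub_good (hY : ∀ i, Y i ≤ kerPow g i) (hY0 : ∀ i, l < i → Y i = ⊥)
    (hYL : ∀ i < l, ∀ y ∈ Y (i + 1), y ∈ Lsub g (i + 1) → y = 0)
    (hYP : ∀ i < l, Y (i + 1) ⊔ Lsub g (i + 1) = P (i + 1)) :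
    Good g l P (Tsub g Y l) where
  inv x hx := by
    rcases l with _ | l
    · have : x = 0 := hx
      simp [this]
    · exact Tsub_mono (Nat.le_succ l) (Tsub_g hY l x hx)
  img i hi := by
    rw [← hYP i hi]
    apply le_antisymm
    · refine sup_le ?_ le_sup_right
      rintro x ⟨hx, hxk⟩
      have := Tsub_cap hY hY0 hYL (show i + 1 ≤ l by omega) x hx hxk
      obtain ⟨t, ht, w, hw, rfl⟩ := Submodule.mem_sup.mp this
      rw [Wsub_eq] at hw
      obtain ⟨y, hy, _, ⟨w', hw', rfl⟩, rfl⟩ := Submodule.mem_sup.mp hw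
      refine add_mem (Submodule.mem_sup_right (kerPow_le_Lsub g i (Tsub_le_kerPow hY _ ht)))
        (add_mem (Submodule.mem_sup_left hy) (Submodule.mem_sup_right (Submodule.mem_sup_left
          ⟨w', Wsub_le_kerPow hY _ hw', rfl⟩)))
    · refine sup_le_sup_right (le_inf ?_ (hY _)) _
      refine le_trans ?_ (Tsub_mono (show i + 1 ≤ l by omega))
      refine le_trans ?_ le_sup_right
      rw [Wsub_eq]; exact le_sup_left
  cap i hi x hx hxL := by
    have := Tsub_cap hY hY0 hYL (show i + 1 ≤ l by omega) x hx (Lsub_le g i hxL)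
    obtain ⟨t, ht, w, hw, rfl⟩ := Submodule.mem_sup.mp this
    rw [Wsub_eq] at hw
    obtain ⟨y, hy, _, ⟨w', hw', rfl⟩, rfl⟩ := Submodule.mem_sup.mp hw
    have htK := Tsub_le_kerPow hY _ ht
    have hw'K := Wsub_le_kerPow hY _ hw'
    have hyL : y ∈ Lsub g (i + 1) := by
      have h1 := (Lsub g (i + 1)).sub_mem ((Lsub g (i + 1)).sub_mem hxL (kerPow_le_Lsub g i htK))
        (Submodule.mem_sup_left ⟨w', hw'K, rfl⟩ : g w' ∈ Lsub g (i + 1))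
      rwa [add_sub_cancel_left, add_sub_cancel_right] at h1
    have hy0 := hYL i hi y hy hyL
    subst hy0
    refine ⟨w', ?_, hw'K, t, Tsub_mono hi.le ht, htK, by abel⟩
    rcases Nat.lt_or_ge (i + 1) l with h | h
    · exact Tsub_mono (show i + 2 ≤ l by omega) (Submodule.mem_sup_right hw')
    · have : Wsub g Y (i + 1 + 1) = ⊥ := by
        refine iSup_eq_bot.mpr fun k => ?_
        rw [hY0 _ (by omega), Submodule.map_bot]
      rw [this] at hw'
      rw [(Submodule.mem_bot R).mp hw']; exact zero_mem _

lemma Wsub_le {T : Submodule R M} (hT : ∀ x ∈ T, g x ∈ T) (hYT : ∀ i, 1 ≤ i → Y i ≤ T) (i : ℕ) :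
    Wsub g Y (i + 1) ≤ T := by
  refine iSup_le fun k => ?_
  rintro _ ⟨y, hy, rfl⟩
  have hyT := hYT _ (by omega) hy
  clear hy
  induction k with
  | zero => simpa using hyT
  | succ k ih => rw [pow_succ', Module.End.mul_apply]; exact hT _ ih

lemma Tsub_le {T : Submodule R M} (hT : ∀ x ∈ T, g x ∈ T) (hYT : ∀ i, 1 ≤ i → Y i ≤ T) (i : ℕ) :
    Tsub g Y i ≤ T := by
  induction i with
  | zero => exact bot_le
  | succ i ih => exact sup_le ih (Wsub_le hT hYT i)

lemma le_Tsub {i : ℕ} (hi : i < l) : Y (i + 1) ≤ Tsub g Y l := by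
  refine le_trans ?_ (Tsub_mono (show i + 1 ≤ l by omega))
  refine le_trans ?_ le_sup_right
  rw [Wsub_eq]; exact le_sup_left

end Ysec
end goodsec

section quot
variable {Kk L : Submodule R M}

/-- preimage in `M` of a submodule of `Kk / L` -/
def Psub (Kk L : Submodule R M) (Q : Submodule R (↥Kk ⧸ L.comap Kk.subtype)) : Submodule R M :=
  (Q.comap (L.comap Kk.subtype).mkQ).map Kk.subtype

lemma rix_Psub (Q : Submodule R (↥Kk ⧸ L.comap Kk.subtype)) :
    rix (Psub Kk L Q) Kk = Q.toAddSubgroup.index := by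
  have h1 : rix (Psub Kk L Q) Kk = ((Psub Kk L Q).comap Kk.subtype).toAddSubgroup.index := rfl
  rw [h1, Psub, Submodule.comap_map_eq_of_injective Kk.injective_subtype]
  exact AddSubgroup.index_comap_of_surjective Q.toAddSubgroup
    (f := (L.comap Kk.subtype).mkQ.toAddMonoidHom) (Submodule.mkQ_surjective _)

lemma map_mkQ_iff (hL : L ≤ Kk) (S : Submodule R M) (Q : Submodule R (↥Kk ⧸ L.comap Kk.subtype)) :
    (S.comap Kk.subtype).map (L.comap Kk.subtype).mkQ = Q ↔ (S ⊓ Kk) ⊔ L = Psub Kk L Q := by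
  have h1 : (S ⊓ Kk) ⊔ L =
      (((S.comap Kk.subtype).map (L.comap Kk.subtype).mkQ).comap
        (L.comap Kk.subtype).mkQ).map Kk.subtype := by
    rw [Submodule.comap_map_mkQ, Submodule.map_sup, Submodule.map_comap_subtype,
      Submodule.map_comap_subtype, inf_of_le_right hL, sup_comm, inf_comm]
  rw [h1, Psub]
  constructor
  · rintro rfl; rfl
  · intro h
    exact Submodule.comap_injective_of_surjective (Submodule.mkQ_surjective _)
      (Submodule.map_injective_of_injective Kk.injective_subtype h)

lemma lift_sup {ι : Type*} {Q : Submodule R (↥Kk ⧸ L.comap Kk.subtype)}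
    (b : Module.Basis ι R Q) (y : ι → Kk)
    (hy : ∀ q, (L.comap Kk.subtype).mkQ (y q) = (b q : _)) (hL : L ≤ Kk) :
    Submodule.span R (Set.range fun q => (y q : M)) ⊔ L = Psub Kk L Q := by
  have h0 : Submodule.span R (Set.range fun q => (y q : M)) =
      (Submodule.span R (Set.range y)).map Kk.subtype := by
    rw [Submodule.map_span, ← Set.range_comp]; rfl
  have hle : Submodule.span R (Set.range fun q => (y q : M)) ≤ Kk := by
    rw [Submodule.span_le]; rintro _ ⟨q, rfl⟩; exact (y q).2
  have := (map_mkQ_iff hL (Submodule.span R (Set.range fun q => (y q : M))) Q).mp ?_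
  · rwa [inf_of_le_left hle] at this
  · rw [h0, Submodule.comap_map_eq_of_injective Kk.injective_subtype, Submodule.map_span,
      ← Set.range_comp]
    have h2 : ((L.comap Kk.subtype).mkQ ∘ y) = Q.subtype ∘ b := by
      funext q; exact hy q
    rw [h2, Set.range_comp, ← Submodule.map_span, b.span_eq, Submodule.map_top,
      Submodule.range_subtype]

lemma lift_disj {ι : Type*} [Fintype ι] {Q : Submodule R (↥Kk ⧸ L.comap Kk.subtype)}
    (b : Module.Basis ι R Q) (y : ι → Kk)
    (hy : ∀ q, (L.comap Kk.subtype).mkQ (y q) = (b q : _)) :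
    ∀ x ∈ Submodule.span R (Set.range fun q => (y q : M)), x ∈ L → x = 0 := by
  intro x hx hxL
  obtain ⟨c, rfl⟩ := (Submodule.mem_span_range_iff_exists_fun R).mp hx
  have h1 : (L.comap Kk.subtype).mkQ (∑ q, c q • y q) = 0 := by
    rw [Submodule.mkQ_apply, Submodule.Quotient.mk_eq_zero, Submodule.mem_comap]
    simpa using hxL
  have h2 : ∑ q, c q • b q = 0 := by
    apply Q.injective_subtype
    rw [map_sum] at h1 ⊢
    rw [map_zero, ← h1]
    refine Finset.sum_congr rfl fun q _ => ?_
    rw [map_smul, map_smul, hy]; rfl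
  have h3 := Fintype.linearIndependent_iff.mp b.linearIndependent c h2
  simp [h3]

end quot

section conv
variable {g : M →ₗ[R] M} {l : ℕ} {S : Submodule R M}

lemma mem_kerPow_restrict (hSg : ∀ x ∈ S, g x ∈ S) (i : ℕ) (x : S) :
    x ∈ kerPow (g.restrict hSg) i ↔ (x : M) ∈ kerPow g i := by
  rw [mem_kerPow, mem_kerPow, Module.End.pow_restrict i hSg]
  rw [← Subtype.coe_inj]; rfl

lemma mem_Lsub_restrict (hSg : ∀ x ∈ S, g x ∈ S) (i : ℕ) (x : S) :
    x ∈ Lsub (g.restrict hSg) (i + 1) ↔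
      ∃ s ∈ S, s ∈ kerPow g (i + 2) ∧ ∃ t ∈ S, t ∈ kerPow g i ∧ (x : M) = g s + t := by
  rw [Lsub_succ, Submodule.mem_sup]
  constructor
  · rintro ⟨_, ⟨s, hs, rfl⟩, t, ht, rfl⟩
    exact ⟨s, s.2, (mem_kerPow_restrict hSg _ _).mp hs, t, t.2,
      (mem_kerPow_restrict hSg _ _).mp ht, rfl⟩
  · rintro ⟨s, hs, hsk, t, ht, htk, h⟩
    exact ⟨_, ⟨⟨s, hs⟩, (mem_kerPow_restrict hSg _ _).mpr hsk, rfl⟩, ⟨t, ht⟩,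
      (mem_kerPow_restrict hSg _ _).mpr htk, Subtype.ext h.symm⟩

/-- the map `K_i(S) → Q_i(M)` -/
def toQ (hSg : ∀ x ∈ S, g x ∈ S) (i : ℕ) : ↥(kerPow (g.restrict hSg) i) →ₗ[R] Qquot g i :=
  ((Lsub g i).comap (kerPow g i).subtype).mkQ ∘ₗ
    LinearMap.codRestrict (kerPow g i) (S.subtype ∘ₗ (kerPow (g.restrict hSg) i).subtype)
      (fun x => (mem_kerPow_restrict hSg i x.1).mp x.2)

lemma range_toQ (hSg : ∀ x ∈ S, g x ∈ S) (i : ℕ) : LinearMap.range (toQ hSg i) =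
    (S.comap (kerPow g i).subtype).map ((Lsub g i).comap (kerPow g i).subtype).mkQ := by
  rw [toQ, LinearMap.range_comp]
  congr 1
  ext x
  constructor
  · rintro ⟨s, rfl⟩
    exact s.1.2
  · intro hx
    exact ⟨⟨⟨x.1, hx⟩, (mem_kerPow_restrict hSg i _).mpr x.2⟩, rfl⟩

lemma ker_toQ (hSg : ∀ x ∈ S, g x ∈ S) (i : ℕ)
    (hcap : ∀ x ∈ S, x ∈ Lsub g (i + 1) →
    ∃ s ∈ S, s ∈ kerPow g (i + 2) ∧ ∃ t ∈ S, t ∈ kerPow g i ∧ x = g s + t) :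
    LinearMap.ker (toQ hSg (i + 1)) =
      (Lsub (g.restrict hSg) (i + 1)).comap (kerPow (g.restrict hSg) (i + 1)).subtype := by
  ext x
  have h1 : x ∈ LinearMap.ker (toQ hSg (i + 1)) ↔ (x.1.1 : M) ∈ Lsub g (i + 1) := by
    rw [LinearMap.mem_ker, toQ, LinearMap.comp_apply, Submodule.mkQ_apply,
      Submodule.Quotient.mk_eq_zero]
    rfl
  rw [h1, Submodule.mem_comap]
  change _ ↔ x.1 ∈ _
  rw [mem_Lsub_restrict]
  constructor
  · exact hcap _ x.1.2
  · rintro ⟨s, _, hsk, t, _, htk, h⟩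
    rw [h]
    exact add_mem (Submodule.mem_sup_left ⟨s, hsk, rfl⟩) (kerPow_le_Lsub g i htk)

lemma std_iff_good [IsDomain R] [CharZero R] (hg : g ^ l = 0)
    (Rs : (i : ℕ) → Submodule R (Qquot g i))
    (hfree : ∀ i, 1 ≤ i → i ≤ l → Module.Free R ↥(Rs i))
    (hind : ∀ i, 1 ≤ i → i ≤ l → (Rs i).toAddSubgroup.index ≠ 0) :
    (∃ hSg : ∀ x ∈ S, g x ∈ S,
          S.toAddSubgroup.index ≠ 0 ∧
          (∀ i, 1 ≤ i → i ≤ l → Module.Free R (Qquot (g.restrict hSg) i)) ∧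
          (∀ i, 1 ≤ i → i ≤ l →
            (S.comap (kerPow g i).subtype).map
              ((Lsub g i).comap (kerPow g i).subtype).mkQ = Rs i)) ↔
    Good g l (fun i => Psub (kerPow g i) (Lsub g i) (Rs i)) S := by
  constructor
  · rintro ⟨hSg, hidx, hfr, him⟩
    refine ⟨hSg, fun i hi => (map_mkQ_iff (Lsub_le g i) S _).mp (him (i + 1) (by omega) hi), ?_⟩
    intro i hi x hx hxL
    have hf := hfr (i + 1) (by omega) hi
    have key := mem_Lsub_restrict hSg i ⟨x, hx⟩
    refine key.mp ?_
    set N := S.toAddSubgroup.index with hN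
    have hNS : ∀ z : M, N • z ∈ S := fun z => S.toAddSubgroup.nsmul_index_mem z
    obtain ⟨_, ⟨a, ha, rfl⟩, c, hc, hac⟩ := Submodule.mem_sup.mp hxL
    have hNx : N • (⟨x, hx⟩ : S) ∈ Lsub (g.restrict hSg) (i + 1) := by
      rw [mem_Lsub_restrict]
      refine ⟨N • a, hNS a, (kerPow g (i + 2)).smul_of_tower_mem N ha, N • c, hNS c,
        (kerPow g i).smul_of_tower_mem N hc, ?_⟩
      rw [map_nsmul, ← smul_add, hac]; rfl
    have hxK : (⟨x, hx⟩ : S) ∈ kerPow (g.restrict hSg) (i + 1) :=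
      (mem_kerPow_restrict hSg _ _).mpr (Lsub_le g i hxL)
    let xi : ↥(kerPow (g.restrict hSg) (i + 1)) := ⟨⟨x, hx⟩, hxK⟩
    have hq : (N : R) • (Submodule.Quotient.mk xi : Qquot (g.restrict hSg) (i + 1)) = 0 := by
      rw [← Submodule.Quotient.mk_smul, Submodule.Quotient.mk_eq_zero, Submodule.mem_comap,
        Nat.cast_smul_eq_nsmul, map_nsmul]
      exact hNx
    have hq0 := (smul_eq_zero.mp hq).resolve_left (by exact_mod_cast hidx)
    rw [Submodule.Quotient.mk_eq_zero] at hq0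
    exact hq0
  · intro hS
    have him : ∀ i, 1 ≤ i → i ≤ l →
            (S.comap (kerPow g i).subtype).map
              ((Lsub g i).comap (kerPow g i).subtype).mkQ = Rs i := by
      intro i h1 h2
      obtain ⟨i, rfl⟩ : ∃ k, i = k + 1 := ⟨i - 1, by omega⟩
      exact (map_mkQ_iff (Lsub_le g i) S _).mpr (hS.img i h2)
    refine ⟨hS.inv, hS.index_ne_zero hg fun i hi => ?_, fun i h1 h2 => ?_, him⟩
    · rw [rix_Psub]; exact hind _ (by omega) hi
    · have hr := range_toQ hS.inv i
      rw [him i h1 h2] at hr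
      obtain ⟨i, rfl⟩ : ∃ k, i = k + 1 := ⟨i - 1, by omega⟩
      have hk := ker_toQ hS.inv i (hS.cap i h2)
      have := hfree _ h1 h2
      exact Module.Free.of_equiv ((Submodule.quotEquivOfEq _ _ hk.symm).trans
        ((toQ hS.inv (i + 1)).quotKerEquivRange.trans (LinearEquiv.ofEq _ _ hr))).symm

end conv

lemma index_pi_sub {ι : Type*} [Fintype ι] [DecidableEq ι] (L : ι → Submodule R M)
    (S : Submodule R M) :
    (Submodule.pi Set.univ (fun p => S.comap (L p).subtype)).toAddSubgroup.index =
      ∏ p, rix S (L p) := by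
  have h := Nat.card_congr
    (Submodule.quotientPi (fun p => S.comap (L p).subtype)).toEquiv
  rw [Nat.card_pi] at h
  exact h

end core

lemma count_arith (l : ℕ) (r h ell : ℕ → ℕ) (hh : ∀ i < l, h (i + 1) ≠ 0)
    (hell : ∀ i < l, ell i * h (i + 1) = ∏ m ∈ Finset.Icc 1 (i + 1), ∏ j ∈ Finset.Icc m l, h j) :
    ∏ i : Fin l, ell i ^ r (i + 1) =
      ∏ i ∈ Finset.Icc 1 l,
        ((∏ j ∈ Finset.Icc i l, h j) ^ (∑ j ∈ Finset.Icc i l, r j) / h i ^ r i) := by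
  have hh' : ∀ i ∈ Finset.Icc 1 l, h i ≠ 0 := by
    intro i hi
    rw [Finset.mem_Icc] at hi
    obtain ⟨i, rfl⟩ : ∃ k, i = k + 1 := ⟨i - 1, by omega⟩
    exact hh i (by omega)
  have hpos : 0 < ∏ i ∈ Finset.Icc 1 l, h i ^ r i :=
    Finset.prod_pos fun i hi => pow_pos (Nat.pos_of_ne_zero (hh' i hi)) _
  have hconv : ∀ f : ℕ → ℕ, ∏ i : Fin l, f (i + 1) = ∏ i ∈ Finset.Icc 1 l, f i := by
    intro f
    rw [Fin.prod_univ_eq_prod_range (fun i => f (i + 1)) l, Finset.range_eq_Ico,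
      Finset.prod_Ico_add' f 0 l 1]
    rfl
  apply Nat.eq_of_mul_eq_mul_right hpos
  rw [← Finset.prod_mul_distrib]
  have hdvd : ∀ i ∈ Finset.Icc 1 l, h i ^ r i ∣
      (∏ j ∈ Finset.Icc i l, h j) ^ (∑ j ∈ Finset.Icc i l, r j) := by
    intro i hi
    have hi' : i ∈ Finset.Icc i l := by simp only [Finset.mem_Icc] at *; omega
    exact (pow_dvd_pow_of_dvd (Finset.dvd_prod_of_mem h hi') _).trans
      (pow_dvd_pow _ (Finset.single_le_sum (f := r) (fun _ _ => Nat.zero_le _) hi'))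
  rw [Finset.prod_congr rfl (fun i hi => Nat.div_mul_cancel (hdvd i hi)), ← hconv,
    ← Finset.prod_mul_distrib]
  have h1 : ∀ i : Fin l, ell i ^ r (i + 1) * h (i + 1) ^ r (i + 1) =
      (fun k => (∏ m ∈ Finset.Icc 1 k, ∏ j ∈ Finset.Icc m l, h j) ^ r k) ((i : ℕ) + 1) := by
    intro i
    rw [← mul_pow, hell i i.2]
  rw [Finset.prod_congr rfl (fun i _ => h1 i),
    hconv (fun k => (∏ m ∈ Finset.Icc 1 k, ∏ j ∈ Finset.Icc m l, h j) ^ r k)]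
  simp_rw [← Finset.prod_pow_eq_pow_sum]
  simp_rw [← Finset.prod_pow (Finset.Icc 1 _)]
  apply Finset.prod_comm'
  intro x y
  simp only [Finset.mem_Icc]
  omega

/-- Let `(M,g)` be an integral `P_l(𝓞)`-module and for `1 ≤ i ≤ l` let
`R_i ⊆ Q_i(M)` be a free `𝓞`-submodule of rank `r_i` and finite additive index `h_i`.
Then the number of standard submodules `S` of finite index in `M` with `R_i(S) = R_i` for
all `i` (where `R_i(S)` is the image of `Q_i(S)` in `Q_i(M)`) equals
`∏_{i=1}^l (h_i ⋯ h_l)^{r_i + ⋯ + r_l} / h_i^{r_i}`. -/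
theorem count_standard_submodules
    {K : Type*} [Field K] [NumberField K]
    {M : Type*} [AddCommGroup M] [Module (𝓞 K) M]
    [Module.Free ℤ M] [Module.Finite ℤ M]
    (l : ℕ) (hl : 1 ≤ l) (g : M →ₗ[𝓞 K] M) (hg : g ^ l = 0)
    (r h : ℕ → ℕ)
    (R : (i : ℕ) → Submodule (𝓞 K) (Qquot g i))
    (hR : ∀ i, 1 ≤ i → i ≤ l →
      Module.Free (𝓞 K) ↥(R i) ∧ Module.finrank (𝓞 K) ↥(R i) = r i ∧
      (R i).toAddSubgroup.index = h i ∧ h i ≠ 0) :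
    Nat.card {S : Submodule (𝓞 K) M //
        ∃ hSg : ∀ x ∈ S, g x ∈ S,
          S.toAddSubgroup.index ≠ 0 ∧
          (∀ i, 1 ≤ i → i ≤ l → Module.Free (𝓞 K) (Qquot (g.restrict hSg) i)) ∧
          (∀ i, 1 ≤ i → i ≤ l →
            (S.comap (kerPow g i).subtype).map
              ((Lsub g i).comap (kerPow g i).subtype).mkQ = R i)} =
      ∏ i ∈ Finset.Icc 1 l,
        ((∏ j ∈ Finset.Icc i l, h j) ^ (∑ j ∈ Finset.Icc i l, r j) / h i ^ r i) := by
  classical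
  have : Module.Finite (𝓞 K) M := Module.Finite.of_restrictScalars_finite ℤ (𝓞 K) M
  have hfree : ∀ i, 1 ≤ i → i ≤ l → Module.Free (𝓞 K) ↥(R i) := fun i h1 h2 => (hR i h1 h2).1
  have hind : ∀ i, 1 ≤ i → i ≤ l → (R i).toAddSubgroup.index ≠ 0 := fun i h1 h2 => by
    rw [(hR i h1 h2).2.2.1]; exact (hR i h1 h2).2.2.2
  set P : ℕ → Submodule (𝓞 K) M := fun i => Psub (kerPow g i) (Lsub g i) (R i) with hPdef
  have hstd : ∀ S : Submodule (𝓞 K) M, _ ↔ Good g l P S :=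
    fun S => std_iff_good (S := S) hg R hfree hind
  have hPh : ∀ i, 1 ≤ i → i ≤ l → rix (P i) (kerPow g i) = h i := fun i h1 h2 => by
    rw [hPdef, rix_Psub, (hR i h1 h2).2.2.1]
  have hP0 : ∀ i < l, rix (P (i + 1)) (kerPow g (i + 1)) ≠ 0 := fun i hi => by
    rw [hPh _ (by omega) hi]; exact (hR _ (by omega) hi).2.2.2
  have hb : ∀ i : Fin l, Nonempty (Module.Basis (Fin (r (i + 1))) (𝓞 K) (R (i + 1))) := by
    intro i
    obtain ⟨h1, h2, -⟩ := hR (i + 1) (by omega) i.2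
    exact ⟨Module.finBasisOfFinrankEq _ _ h2⟩
  let b := fun i => (hb i).some
  have hy0 : ∀ p : (Σ i : Fin l, Fin (r (i + 1))), ∃ y : kerPow g (p.1 + 1),
      ((Lsub g (p.1 + 1)).comap (kerPow g (p.1 + 1)).subtype).mkQ y = (b p.1 p.2 : Qquot g _) :=
    fun p => Submodule.mkQ_surjective _ _
  choose y0 hy0 using hy0
  let A := ∀ p : (Σ i : Fin l, Fin (r (i + 1))), ↥(Lsub g (p.1 + 1))
  have hAfin : Module.Finite ℤ A := by
    have : ∀ p : (Σ i : Fin l, Fin (r (i + 1))), Module.Finite ℤ ↥(Lsub g (p.1 + 1)) := fun p =>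
      inferInstanceAs (Module.Finite ℤ ((Lsub g (p.1 + 1)).restrictScalars ℤ))
    exact Module.Finite.pi
  let yy : A → ∀ p : (Σ i : Fin l, Fin (r (i + 1))), kerPow g (p.1 + 1) := fun a p =>
    y0 p + ⟨(a p : M), Lsub_le g _ (a p).2⟩
  have hyy : ∀ a p, ((Lsub g (p.1 + 1)).comap (kerPow g (p.1 + 1)).subtype).mkQ (yy a p)
      = (b p.1 p.2 : Qquot g _) := by
    intro a p
    rw [map_add, hy0]
    refine add_eq_left.mpr ?_
    rw [Submodule.mkQ_apply, Submodule.Quotient.mk_eq_zero]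
    exact (a p).2
  let Y : A → ℕ → Submodule (𝓞 K) M := fun a i =>
    Submodule.span (𝓞 K) {x | ∃ p : (Σ i : Fin l, Fin (r (i + 1))), (p.1 : ℕ) + 1 = i ∧
      x = (yy a p : M)}
  have hY : ∀ a i, Y a i ≤ kerPow g i := by
    intro a i
    refine Submodule.span_le.mpr ?_
    rintro _ ⟨p, rfl, rfl⟩
    exact (yy a p).2
  have hY0 : ∀ a i, l < i → Y a i = ⊥ := by
    intro a i hi
    refine Submodule.span_eq_bot.mpr ?_
    rintro _ ⟨p, rfl, rfl⟩
    have := p.1.2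
    omega
  have hYr : ∀ a (i : ℕ) (hi : i < l), Y a (i + 1) =
      Submodule.span (𝓞 K) (Set.range fun q : Fin (r (i + 1)) => (yy a ⟨⟨i, hi⟩, q⟩ : M)) := by
    intro a i hi
    change Submodule.span _ _ = _
    congr 1
    ext x
    constructor
    · rintro ⟨⟨⟨j, hj⟩, q⟩, hji, rfl⟩
      have : j = i := by simpa using hji
      subst this
      exact ⟨q, rfl⟩
    · rintro ⟨q, rfl⟩
      exact ⟨⟨⟨i, hi⟩, q⟩, rfl, rfl⟩
  have hgood : ∀ a, Good g l P (Tsub g (Y a) l) := by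
    intro a
    refine Tsub_good (hY a) (hY0 a) ?_ ?_
    · intro i hi
      rw [hYr a i hi]
      exact lift_disj (b ⟨i, hi⟩) (fun q => yy a ⟨⟨i, hi⟩, q⟩) (fun q => hyy a ⟨⟨i, hi⟩, q⟩)
    · intro i hi
      rw [hYr a i hi]
      exact lift_sup (b ⟨i, hi⟩) (fun q => yy a ⟨⟨i, hi⟩, q⟩) (fun q => hyy a ⟨⟨i, hi⟩, q⟩)
        (Lsub_le g i)
  have hmem : ∀ a p, (yy a p : M) ∈ Tsub g (Y a) l := fun a p =>
    le_Tsub p.1.2 (Submodule.subset_span ⟨p, rfl, rfl⟩)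
  have huniq : ∀ a S, Good g l P S → (∀ p, (yy a p : M) ∈ S) → Tsub g (Y a) l = S := by
    intro a S hS hp
    refine (hgood a).eq_of_le hg hP0 hS (Tsub_le hS.inv (fun i _ => ?_) l)
    refine Submodule.span_le.mpr ?_
    rintro _ ⟨p, rfl, rfl⟩
    exact hp p
  rw [Nat.card_congr (Equiv.subtypeEquivRight hstd)]
  have hcount : ∀ S, Good g l P S →
      (Submodule.pi Set.univ (fun p : (Σ i : Fin l, Fin (r (i + 1))) =>
        S.comap (Lsub g (p.1 + 1)).subtype)).toAddSubgroup.index = ∏ i ∈ Finset.Icc 1 l,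
        ((∏ j ∈ Finset.Icc i l, h j) ^ (∑ j ∈ Finset.Icc i l, r j) / h i ^ r i) := by
    intro S hS
    rw [index_pi_sub (fun p : (Σ i : Fin l, Fin (r (i + 1))) => Lsub g (p.1 + 1)) S,
      Fintype.prod_sigma]
    simp only [Finset.prod_const, Finset.card_univ, Fintype.card_fin]
    refine count_arith l r h (fun i => rix S (Lsub g (i + 1)))
      (fun i hi => (hR _ (by omega) hi).2.2.2) fun i hi => ?_
    have h1 := hS.ell_eq hg hi
    rw [hPh _ (by omega) hi] at h1
    refine h1.trans (Finset.prod_congr rfl fun m hm => Finset.prod_congr rfl fun j hj => ?_)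
    simp only [Finset.mem_Icc] at hm hj
    exact hPh j (by omega) (by omega)
  refine card_of_coset_fibers (A := A)
    (fun a => (⟨Tsub g (Y a) l, hgood a⟩ : {S // Good g l P S})) ?_
    (fun S => (Submodule.pi Set.univ (fun p : (Σ i : Fin l, Fin (r (i + 1))) =>
        S.1.comap (Lsub g (p.1 + 1)).subtype)).toAddSubgroup) _ ?_
    (fun S => hcount S.1 S.2) ?_
  · rintro ⟨S, hS⟩
    have hex : ∀ p : (Σ i : Fin l, Fin (r (i + 1))), ∃ a : Lsub g (p.1 + 1),
        (y0 p : M) + (a : M) ∈ S := by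
      intro p
      have him := (map_mkQ_iff (Lsub_le g p.1) S (R (p.1 + 1))).mpr (hS.img p.1 p.1.2)
      have hbm := him.ge (b p.1 p.2).2
      obtain ⟨x, hx, hxe⟩ := hbm
      rw [← hy0 p] at hxe
      have h2 := (Submodule.Quotient.eq _).mp hxe
      exact ⟨⟨_, h2⟩, by simpa using hx⟩
    choose a ha using hex
    exact ⟨a, Subtype.ext (huniq a S hS ha)⟩
  · refine Finset.prod_ne_zero_iff.mpr fun i hi => ?_
    have hi' : i ∈ Finset.Icc i l := by simp only [Finset.mem_Icc] at *; omega
    have hpos : ∀ j ∈ Finset.Icc i l, 0 < h j := by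
      intro j hj
      simp only [Finset.mem_Icc] at *
      exact Nat.pos_of_ne_zero (hR j (by omega) (by omega)).2.2.2
    have hd : h i ^ r i ∣ (∏ j ∈ Finset.Icc i l, h j) ^ (∑ j ∈ Finset.Icc i l, r j) :=
      (pow_dvd_pow_of_dvd (Finset.dvd_prod_of_mem h hi') _).trans
        (pow_dvd_pow _ (Finset.single_le_sum (f := r) (fun _ _ => Nat.zero_le _) hi'))
    have hp : 0 < (∏ j ∈ Finset.Icc i l, h j) ^ (∑ j ∈ Finset.Icc i l, r j) :=
      pow_pos (Finset.prod_pos hpos) _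
    exact (Nat.div_pos (Nat.le_of_dvd hp hd) (pow_pos (hpos i hi') _)).ne'
  · intro a c
    have hsub : ∀ p, (yy c p : M) = (yy a p : M) + ((c p : M) - (a p : M)) := by
      intro p
      change (y0 p : M) + (c p : M) = (y0 p : M) + (a p : M) + _
      abel
    constructor
    · intro hac
      have hac' : Tsub g (Y a) l = Tsub g (Y c) l := congrArg Subtype.val hac
      intro p _
      change (c p : M) - (a p : M) ∈ Tsub g (Y a) l
      have h1 := hmem c p
      rw [← hac', hsub] at h1
      exact (Submodule.add_mem_iff_right _ (hmem a p)).mp h1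
    · intro hca
      refine Subtype.ext (huniq c _ (hgood a) fun p => ?_).symm
      rw [hsub]
      exact add_mem (hmem a p) (hca p (Set.mem_univ p))
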